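/- Let N ∼ Binomial(n, p), r ≥ 1 an integer, and a ≥ 1 a real constant. Then E[1/(a + N)^r] = 1/(a + np)^r + r(r+1) np(1−p) / (2(a + np)^{r+2}) + R, where |R| ≤ C/(a + np)^{r + 3/2} for a constant C depending only on r. -/

import Mathlib

/-- Expectation of `f(N)` for `N ~ Binomial(n, p)`. -/
noncomputable def binExp (n : ℕ) (p : ℝ) (f : ℕ → ℝ) : ℝ :=
  ∑ k ∈ Finset.range (n + 1), (n.choose k : ℝ) * p ^ k * (1 - p) ^ (n - k) * f k

theorem binExp_add (n : ℕ) (p : ℝ) (f g : ℕ → ℝ) :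
    binExp n p (fun k => f k + g k) = binExp n p f + binExp n p g := by
  simp only [binExp, mul_add, Finset.sum_add_distrib]

theorem binExp_const_mul (n : ℕ) (p c : ℝ) (f : ℕ → ℝ) :
    binExp n p (fun k => c * f k) = c * binExp n p f := by
  simp only [binExp, Finset.mul_sum]
  exact Finset.sum_congr rfl fun k _ => by ring

theorem binExp_finset_sum {ι : Type*} (n : ℕ) (p : ℝ) (s : Finset ι) (f : ι → ℕ → ℝ) :
    binExp n p (fun k => ∑ i ∈ s, f i k) = ∑ i ∈ s, binExp n p (f i) := by
  simp only [binExp, Finset.mul_sum]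
  exact Finset.sum_comm

theorem binExp_mono {n : ℕ} {p : ℝ} (hp : 0 ≤ p) (hp1 : p ≤ 1) {f g : ℕ → ℝ}
    (h : ∀ k, f k ≤ g k) : binExp n p f ≤ binExp n p g := by
  have hq : 0 ≤ 1 - p := sub_nonneg.2 hp1
  exact Finset.sum_le_sum fun k _ => mul_le_mul_of_nonneg_left (h k) (by positivity)

theorem binExp_nonneg {n : ℕ} {p : ℝ} (hp : 0 ≤ p) (hp1 : p ≤ 1) {f : ℕ → ℝ}
    (h : ∀ k, 0 ≤ f k) : 0 ≤ binExp n p f := by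
  simpa [binExp] using binExp_mono (n := n) hp hp1 h

theorem abs_binExp_le {n : ℕ} {p : ℝ} (hp : 0 ≤ p) (hp1 : p ≤ 1) {f g : ℕ → ℝ}
    (h : ∀ k, |f k| ≤ g k) : |binExp n p f| ≤ binExp n p g := by
  refine abs_le.2 ⟨?_, binExp_mono hp hp1 fun k => (abs_le.1 (h k)).2⟩
  have := binExp_mono (n := n) hp hp1 fun k => (by linarith [(abs_le.1 (h k)).1] : -1 * g k ≤ f k)
  rw [binExp_const_mul] at this
  linarith

/-- Conditioning on the last of `n + 1` Bernoulli trials. -/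
theorem binExp_succ (n : ℕ) (p : ℝ) (f : ℕ → ℝ) :
    binExp (n + 1) p f = (1 - p) * binExp n p f + p * binExp n p (fun k => f (k + 1)) := by
  have h : (1 - p) * binExp n p f =
      ∑ k ∈ Finset.range (n + 2), (n.choose k : ℝ) * p ^ k * (1 - p) ^ (n + 1 - k) * f k := by
    rw [Finset.sum_range_succ, Nat.choose_succ_self, binExp, Finset.mul_sum]
    simp only [Nat.cast_zero, zero_mul, add_zero]
    refine Finset.sum_congr rfl fun k hk => ?_
    rw [Nat.succ_sub (Nat.lt_succ_iff.1 (Finset.mem_range.1 hk)), pow_succ]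
    ring
  rw [h, Finset.sum_range_succ' _ (n + 1), binExp, Finset.sum_range_succ' _ (n + 1)]
  simp only [binExp, Finset.mul_sum, Nat.choose_succ_succ, Nat.cast_add, Nat.add_sub_add_right,
    Nat.choose_zero_right]
  rw [add_right_comm, ← Finset.sum_add_distrib]
  congr 1
  exact Finset.sum_congr rfl fun k _ => by ring

theorem binExp_add_const_pow (n : ℕ) (p c : ℝ) (f : ℕ → ℝ) (j : ℕ) :
    binExp n p (fun k => (f k + c) ^ j) =
      ∑ i ∈ Finset.range (j + 1), c ^ (j - i) * (j.choose i : ℝ) *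
        binExp n p (fun k => f k ^ i) := by
  simp only [← binExp_const_mul, ← binExp_finset_sum, add_pow]
  congr 1
  funext k
  exact Finset.sum_congr rfl fun i _ => by ring

theorem binExp_succ_central_pow (n : ℕ) (p : ℝ) (j : ℕ) :
    binExp (n + 1) p (fun k => ((k : ℝ) - ((n + 1 : ℕ) : ℝ) * p) ^ j) =
      ∑ i ∈ Finset.range (j + 1), ((1 - p) * (-p) ^ (j - i) + p * (1 - p) ^ (j - i)) *
        (j.choose i : ℝ) * binExp n p (fun k => ((k : ℝ) - (n : ℝ) * p) ^ i) := by
  have h0 : (fun k : ℕ => ((k : ℝ) - ((n + 1 : ℕ) : ℝ) * p) ^ j) =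
      fun k : ℕ => (((k : ℝ) - (n : ℝ) * p) + -p) ^ j := by
    funext k; push_cast; ring
  have h1 : (fun k : ℕ => (((k + 1 : ℕ) : ℝ) - ((n + 1 : ℕ) : ℝ) * p) ^ j) =
      fun k : ℕ => (((k : ℝ) - (n : ℝ) * p) + (1 - p)) ^ j := by
    funext k; push_cast; ring
  rw [binExp_succ, h0, h1, binExp_add_const_pow, binExp_add_const_pow, Finset.mul_sum,
    Finset.mul_sum, ← Finset.sum_add_distrib]
  exact Finset.sum_congr rfl fun i _ => by ring

theorem binExp_central_moments (n : ℕ) (p : ℝ) :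
    binExp n p (fun k => ((k : ℝ) - n * p) ^ 0) = 1 ∧
    binExp n p (fun k => ((k : ℝ) - n * p) ^ 1) = 0 ∧
    binExp n p (fun k => ((k : ℝ) - n * p) ^ 2) = n * (p * (1 - p)) ∧
    binExp n p (fun k => ((k : ℝ) - n * p) ^ 3) = n * (p * (1 - p)) * (1 - 2 * p) ∧
    binExp n p (fun k => ((k : ℝ) - n * p) ^ 4) =
      n * (p * (1 - p)) * (1 - 6 * (p * (1 - p))) + 3 * (n * (p * (1 - p))) ^ 2 ∧
    binExp n p (fun k => ((k : ℝ) - n * p) ^ 5) = (1 - 2 * p) *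
      (n * (p * (1 - p)) * (1 - 12 * (p * (1 - p))) + 10 * (n * (p * (1 - p))) ^ 2) ∧
    binExp n p (fun k => ((k : ℝ) - n * p) ^ 6) =
      n * (p * (1 - p)) * (1 - 30 * (p * (1 - p)) + 120 * (p * (1 - p)) ^ 2) +
        (n * (p * (1 - p))) ^ 2 * (25 - 130 * (p * (1 - p))) + 15 * (n * (p * (1 - p))) ^ 3 := by
  induction n with
  | zero => simp [binExp]
  | succ n ih =>
    obtain ⟨h0, h1, h2, h3, h4, h5, h6⟩ := ih
    simp only [binExp_succ_central_pow, Finset.sum_range_succ, Finset.sum_range_zero, h0, h1, h2,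
      h3, h4, h5, h6]
    norm_num [Nat.choose]
    refine ⟨?_, ?_, ?_, ?_, ?_, ?_⟩ <;> ring

theorem binExp_central_pow_six_le {n : ℕ} {p m : ℝ} (hp : 0 ≤ p) (hp1 : p ≤ 1) (hm : 1 ≤ m)
    (hnp : n * p ≤ m) : binExp n p (fun k => ((k : ℝ) - n * p) ^ 6) ≤ 41 * m ^ 3 := by
  rw [(binExp_central_moments n p).2.2.2.2.2.2]
  have hn : (0 : ℝ) ≤ n := n.cast_nonneg
  have hv : 0 ≤ p * (1 - p) := mul_nonneg hp (sub_nonneg.2 hp1)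
  have hv4 : p * (1 - p) ≤ 1 / 4 := by nlinarith [sq_nonneg (p - 1 / 2)]
  have hsm : n * (p * (1 - p)) ≤ m := by nlinarith [mul_nonneg hn (mul_nonneg hp hp)]
  have hs : 0 ≤ n * (p * (1 - p)) := mul_nonneg hn hv
  generalize n * (p * (1 - p)) = s at *
  generalize p * (1 - p) = v at *
  have e1 : s * (1 - 30 * v + 120 * v ^ 2) ≤ s * 1 :=
    mul_le_mul_of_nonneg_left (by nlinarith) hs
  have e2 : s ^ 2 * (25 - 130 * v) ≤ s ^ 2 * 25 :=
    mul_le_mul_of_nonneg_left (by linarith) (sq_nonneg s)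
  have e3 : s ^ 2 ≤ m ^ 2 := by gcongr
  have e4 : s ^ 3 ≤ m ^ 3 := by gcongr
  have e5 : m ^ 2 ≤ m ^ 3 := pow_le_pow_right₀ hm (by norm_num)
  have e6 : m ≤ m ^ 3 := le_self_pow₀ hm (by norm_num)
  linarith

theorem binExp_div_succ_le {n : ℕ} {p : ℝ} (_hp : 0 ≤ p) (hp1 : p ≤ 1) {g : ℕ → ℝ}
    (hg : ∀ k, 0 ≤ g k) :
    ((n + 1 : ℕ) : ℝ) * p * binExp n p (fun k => g (k + 1) / ((k : ℝ) + 1)) ≤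
      binExp (n + 1) p g := by
  have hq : 0 ≤ 1 - p := sub_nonneg.2 hp1
  rw [binExp, binExp, Finset.sum_range_succ' _ (n + 1), Finset.mul_sum]
  refine le_add_of_le_of_nonneg (Finset.sum_le_sum fun k _ => le_of_eq ?_)
    (mul_nonneg (by positivity) (hg 0))
  have h : ((n + 1 : ℕ) : ℝ) * (n.choose k : ℝ) =
      ((n + 1).choose (k + 1) : ℝ) * ((k : ℝ) + 1) := by
    exact_mod_cast Nat.add_one_mul_choose_eq n k
  have hk : (k : ℝ) + 1 ≠ 0 := by positivity
  rw [Nat.add_sub_add_right]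
  field_simp
  linear_combination p ^ (k + 1) * (1 - p) ^ (n - k) * g (k + 1) * h

theorem exists_binExp_inv_succ_pow_le (j : ℕ) :
    ∃ C : ℝ, 0 ≤ C ∧ ∀ (n : ℕ) (p : ℝ), 0 ≤ p → p ≤ 1 →
      (n * p) ^ j * binExp n p (fun k => 1 / ((k : ℝ) + 1) ^ j) ≤ C := by
  induction j with
  | zero =>
    refine ⟨1, zero_le_one, fun n p _ _ => ?_⟩
    have := (binExp_central_moments n p).1
    simp only [pow_zero] at this
    simp [this]
  | succ j ih =>
    obtain ⟨C, hC, h⟩ := ih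
    refine ⟨2 ^ j * C, by positivity, fun n p hp hp1 => ?_⟩
    have hnp : (n : ℝ) * p ≤ ((n + 1 : ℕ) : ℝ) * p := by
      push_cast; nlinarith
    have h0 : 0 ≤ binExp n p (fun k => 1 / ((k : ℝ) + 1) ^ (j + 1)) :=
      binExp_nonneg hp hp1 fun k => by positivity
    have h1 : binExp n p (fun k => 1 / ((k : ℝ) + 1) ^ (j + 1)) ≤
        binExp n p (fun k => 2 ^ j * (1 / (((k + 1 : ℕ) : ℝ) + 1) ^ j) / ((k : ℝ) + 1)) := by
      refine binExp_mono hp hp1 fun k => ?_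
      have h2 : (((k + 1 : ℕ) : ℝ) + 1) ^ j ≤ 2 ^ j * ((k : ℝ) + 1) ^ j := by
        rw [← mul_pow]
        gcongr
        push_cast
        linarith [(k.cast_nonneg : (0 : ℝ) ≤ k)]
      rw [pow_succ, ← div_div]
      gcongr
      rw [mul_one_div, div_le_div_iff₀ (by positivity) (by positivity)]
      linarith
    have h2 := binExp_div_succ_le (n := n) hp hp1
      (g := fun k => 2 ^ j * (1 / ((k : ℝ) + 1) ^ j)) fun k => by positivity
    rw [binExp_const_mul] at h2
    have h3 := h (n + 1) p hp hp1
    calc (n * p) ^ (j + 1) * binExp n p (fun k => 1 / ((k : ℝ) + 1) ^ (j + 1))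
        ≤ (((n + 1 : ℕ) : ℝ) * p) ^ (j + 1) *
          binExp n p (fun k => 1 / ((k : ℝ) + 1) ^ (j + 1)) := by gcongr
      _ ≤ (((n + 1 : ℕ) : ℝ) * p) ^ (j + 1) * binExp n p
          (fun k => 2 ^ j * (1 / (((k + 1 : ℕ) : ℝ) + 1) ^ j) / ((k : ℝ) + 1)) := by gcongr
      _ = (((n + 1 : ℕ) : ℝ) * p) ^ j * (((n + 1 : ℕ) : ℝ) * p * binExp n p
          (fun k => 2 ^ j * (1 / (((k + 1 : ℕ) : ℝ) + 1) ^ j) / ((k : ℝ) + 1))) := by ring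
      _ ≤ (((n + 1 : ℕ) : ℝ) * p) ^ j *
          (2 ^ j * binExp (n + 1) p (fun k => 1 / ((k : ℝ) + 1) ^ j)) := by gcongr
      _ = 2 ^ j * ((((n + 1 : ℕ) : ℝ) * p) ^ j *
          binExp (n + 1) p (fun k => 1 / ((k : ℝ) + 1) ^ j)) := by ring
      _ ≤ 2 ^ j * C := by gcongr

theorem exists_binExp_inv_add_pow_le (j : ℕ) :
    ∃ C : ℝ, 0 ≤ C ∧ ∀ (n : ℕ) (p a : ℝ), 0 ≤ p → p ≤ 1 → 1 ≤ a →
      (a + n * p) ^ j * binExp n p (fun k => 1 / (a + (k : ℝ)) ^ j) ≤ C := by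
  obtain ⟨C, hC, h⟩ := exists_binExp_inv_succ_pow_le j
  refine ⟨2 ^ j * (C + 1), by positivity, fun n p a hp hp1 ha => ?_⟩
  have ha0 : 0 < a := by linarith
  have hnp : 0 ≤ n * p := by positivity
  have hnn : 0 ≤ binExp n p (fun k => 1 / (a + (k : ℝ)) ^ j) :=
    binExp_nonneg hp hp1 fun k => by positivity
  rcases le_total (n * p) a with hle | hle
  · have h1 : binExp n p (fun k => 1 / (a + (k : ℝ)) ^ j) ≤
        binExp n p (fun k => 1 / a ^ j * ((k : ℝ) - n * p) ^ 0) := by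
      refine binExp_mono hp hp1 fun k => ?_
      rw [pow_zero, mul_one]
      gcongr
      linarith [(k.cast_nonneg : (0 : ℝ) ≤ k)]
    rw [binExp_const_mul, (binExp_central_moments n p).1, mul_one] at h1
    calc (a + n * p) ^ j * binExp n p (fun k => 1 / (a + (k : ℝ)) ^ j)
        ≤ (2 * a) ^ j * (1 / a ^ j) := by
          gcongr
          linarith
      _ = 2 ^ j * 1 := by rw [mul_pow]; field_simp
      _ ≤ 2 ^ j * (C + 1) := by gcongr; linarith
  · have h1 : binExp n p (fun k => 1 / (a + (k : ℝ)) ^ j) ≤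
        binExp n p (fun k => 1 / ((k : ℝ) + 1) ^ j) := by
      refine binExp_mono hp hp1 fun k => ?_
      gcongr 1 / ?_ ^ j
      linarith
    calc (a + n * p) ^ j * binExp n p (fun k => 1 / (a + (k : ℝ)) ^ j)
        ≤ (2 * (n * p)) ^ j * binExp n p (fun k => 1 / ((k : ℝ) + 1) ^ j) := by
          gcongr
          linarith
      _ = 2 ^ j * ((n * p) ^ j * binExp n p (fun k => 1 / ((k : ℝ) + 1) ^ j)) := by ring
      _ ≤ 2 ^ j * (C + 1) := by gcongr; linarith [h n p hp hp1]

theorem exists_abs_pow_sub_taylor_le (r : ℕ) :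
    ∃ K : ℝ, 0 ≤ K ∧ ∀ t s : ℝ, 0 < t → t * (1 + s) = 1 →
      |t ^ r - (1 - r * s + r * (r + 1) / 2 * s ^ 2)| ≤ K * |s| ^ 3 * (t ^ r + 1) := by
  induction r with
  | zero => exact ⟨0, le_rfl, fun t s _ _ => by simp⟩
  | succ r ih =>
    obtain ⟨K, hK, h⟩ := ih
    refine ⟨2 * K + (r + 1) * (r + 2) / 2, by positivity, fun t s ht hts => ?_⟩
    have e : t ^ (r + 1) - (1 - ((r + 1 : ℕ) : ℝ) * s +
          ((r + 1 : ℕ) : ℝ) * (((r + 1 : ℕ) : ℝ) + 1) / 2 * s ^ 2) =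
        t * (t ^ r - (1 - r * s + r * (r + 1) / 2 * s ^ 2)) -
          (r + 1) * (r + 2) / 2 * t * s ^ 3 := by
      push_cast
      linear_combination (1 - (r + 1) * s + (r + 1) * (r + 2) / 2 * s ^ 2) * hts
    have ht1 : t ≤ t ^ (r + 1) + 1 := by
      rcases le_total t 1 with h1 | h1
      · have : 0 < t ^ (r + 1) := by positivity
        linarith
      · have : t ≤ t ^ (r + 1) := le_self_pow₀ h1 r.succ_ne_zero
        linarith
    rw [e]
    calc _ ≤ |t * (t ^ r - (1 - r * s + r * (r + 1) / 2 * s ^ 2))| +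
          |(r + 1) * (r + 2) / 2 * t * s ^ 3| := abs_sub _ _
      _ = t * |t ^ r - (1 - r * s + r * (r + 1) / 2 * s ^ 2)| +
          (r + 1) * (r + 2) / 2 * |s| ^ 3 * t := by
        rw [abs_mul, abs_of_pos ht, abs_mul, abs_pow,
          abs_of_nonneg (by positivity : 0 ≤ ((r : ℝ) + 1) * (r + 2) / 2 * t)]
        ring
      _ ≤ t * (K * |s| ^ 3 * (t ^ r + 1)) + (r + 1) * (r + 2) / 2 * |s| ^ 3 * t := by
        gcongr
        exact h t s ht hts
      _ = K * |s| ^ 3 * (t ^ (r + 1) + t) + (r + 1) * (r + 2) / 2 * |s| ^ 3 * t := by ring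
      _ ≤ K * |s| ^ 3 * (2 * (t ^ (r + 1) + 1)) +
          (r + 1) * (r + 2) / 2 * |s| ^ 3 * (t ^ (r + 1) + 1) := by
        have : 0 < t ^ (r + 1) := by positivity
        gcongr
        linarith
      _ = _ := by ring

/-- Taylor's formula of second order for `x ↦ 1 / x ^ r` at `m`. -/
theorem exists_abs_inv_pow_sub_taylor_le (r : ℕ) :
    ∃ K : ℝ, 0 ≤ K ∧ ∀ x m : ℝ, 0 < x → 0 < m →
      |1 / x ^ r - (1 / m ^ r + -(r / m ^ (r + 1)) * (x - m) +
          r * (r + 1) / (2 * m ^ (r + 2)) * (x - m) ^ 2)| ≤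
        K / m ^ 3 * (|x - m| ^ 3 * (1 / x ^ r + 1 / m ^ r)) := by
  obtain ⟨K, hK, h⟩ := exists_abs_pow_sub_taylor_le r
  refine ⟨K, hK, fun x m hx hm => ?_⟩
  have h1 := h (m / x) ((x - m) / m) (by positivity) (by field_simp; ring)
  have e : 1 / x ^ r - (1 / m ^ r + -(r / m ^ (r + 1)) * (x - m) +
        r * (r + 1) / (2 * m ^ (r + 2)) * (x - m) ^ 2) =
      1 / m ^ r * ((m / x) ^ r - (1 - r * ((x - m) / m) +
        r * (r + 1) / 2 * ((x - m) / m) ^ 2)) := by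
    rw [div_pow, pow_add m r 1, pow_add m r 2]
    field_simp
    ring
  rw [e, abs_mul, abs_of_pos (by positivity : 0 < 1 / m ^ r)]
  calc _ ≤ 1 / m ^ r * (K * |(x - m) / m| ^ 3 * ((m / x) ^ r + 1)) := by gcongr
    _ = _ := by
      rw [abs_div, abs_of_pos hm, div_pow m x r]
      field_simp

/-- for `N ~ Binomial(n,p)`, `r ≥ 1` an integer, `a ≥ 1`,
`E[1/(a+N)^r] = 1/(a+np)^r + r(r+1)np(1−p)/(2(a+np)^{r+2}) + R` with
`|R| ≤ C/(a+np)^{r+3/2}`, `C` depending only on `r`. -/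
theorem stmt3 (r : ℕ) (hr : 1 ≤ r) :
    ∃ C : ℝ, 0 < C ∧ ∀ (n : ℕ) (p a : ℝ), 0 ≤ p → p ≤ 1 → 1 ≤ a →
      |binExp n p (fun k => 1 / (a + (k : ℝ)) ^ r) - 1 / (a + (n : ℝ) * p) ^ r
          - (r : ℝ) * ((r : ℝ) + 1) * (n : ℝ) * p * (1 - p)
            / (2 * (a + (n : ℝ) * p) ^ (r + 2))|
        ≤ C / (a + (n : ℝ) * p) ^ ((r : ℝ) + 3 / 2) := by
  obtain ⟨K, hK, hT⟩ := exists_abs_inv_pow_sub_taylor_le r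
  obtain ⟨C, hC, hI⟩ := exists_binExp_inv_add_pow_le (2 * r)
  refine ⟨K * (41 + C + 1) + 1, by positivity, fun n p a hp hp1 ha => ?_⟩
  have hnp : 0 ≤ n * p := by positivity
  have hI' := hI n p a hp hp1 ha
  obtain ⟨m, hm⟩ : ∃ m, m = a + n * p := ⟨_, rfl⟩
  rw [← hm] at hI' ⊢
  have hm1 : 1 ≤ m := by linarith
  have hm0 : 0 < m := by linarith
  obtain ⟨P, hP⟩ : ∃ P, P = m ^ ((r : ℝ) + 3 / 2) := ⟨_, rfl⟩
  have hP0 : 0 < P := hP ▸ Real.rpow_pos_of_pos hm0 _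
  have hP2 : P ^ 2 = m ^ (2 * r + 3) := by
    rw [hP, ← Real.rpow_natCast, ← Real.rpow_mul hm0.le, ← Real.rpow_natCast]
    congr 1
    push_cast
    ring
  rw [← hP]
  obtain ⟨M0, M1, M2, -, -, -, -⟩ := binExp_central_moments n p
  have M6 := binExp_central_pow_six_le hp hp1 hm1 (by linarith)
  have hsplit : binExp n p (fun k => 1 / (a + (k : ℝ)) ^ r) - 1 / m ^ r
      - (r : ℝ) * ((r : ℝ) + 1) * (n : ℝ) * p * (1 - p) / (2 * m ^ (r + 2)) =
      binExp n p (fun k => 1 / (a + (k : ℝ)) ^ r +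
        ((-(1 / m ^ r)) * ((k : ℝ) - n * p) ^ 0 + (r / m ^ (r + 1) * ((k : ℝ) - n * p) ^ 1 +
          (-(r * (r + 1) / (2 * m ^ (r + 2)))) * ((k : ℝ) - n * p) ^ 2))) := by
    simp only [binExp_add, binExp_const_mul, M0, M1, M2]
    ring
  have hpt : ∀ k : ℕ, |1 / (a + (k : ℝ)) ^ r +
        ((-(1 / m ^ r)) * ((k : ℝ) - n * p) ^ 0 + (r / m ^ (r + 1) * ((k : ℝ) - n * p) ^ 1 +
          (-(r * (r + 1) / (2 * m ^ (r + 2)))) * ((k : ℝ) - n * p) ^ 2))| ≤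
      K / m ^ 3 / P * ((k : ℝ) - n * p) ^ 6 + (K / m ^ 3 * P * (1 / (a + (k : ℝ)) ^ (2 * r)) +
        K / m ^ 3 * P / m ^ (2 * r) * ((k : ℝ) - n * p) ^ 0) := by
    intro k
    have hx : 0 < a + (k : ℝ) := by positivity
    have hd : a + (k : ℝ) - m = k - n * p := by rw [hm]; ring
    have h := hT (a + k) m hx hm0
    rw [hd] at h
    refine (le_of_eq ?_).trans (h.trans ?_)
    · congr 1
      ring
    have h1 : |(k : ℝ) - n * p| ^ 3 * (1 / (a + k) ^ r + 1 / m ^ r) ≤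
        1 / P * ((k : ℝ) - n * p) ^ 6 + P * ((1 / (a + k) ^ r) ^ 2 + (1 / m ^ r) ^ 2) := by
      have h6 : ((k : ℝ) - n * p) ^ 6 = (|(k : ℝ) - n * p| ^ 3) ^ 2 := by
        rw [← pow_mul, Even.pow_abs (by decide)]
      rw [h6]
      generalize |(k : ℝ) - n * p| ^ 3 = u
      generalize 1 / (a + (k : ℝ)) ^ r = v
      generalize 1 / m ^ r = w
      have h2 : 1 / P * u ^ 2 + P * (v ^ 2 + w ^ 2) - u * (v + w) =
          P * ((u / P / 2 - v) ^ 2 + (u / P / 2 - w) ^ 2 + (u / P) ^ 2 / 2) := by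
        field_simp
        ring
      have h3 : 0 ≤ P * ((u / P / 2 - v) ^ 2 + (u / P / 2 - w) ^ 2 + (u / P) ^ 2 / 2) := by
        positivity
      linarith
    refine (mul_le_mul_of_nonneg_left h1 (by positivity)).trans (le_of_eq ?_)
    rw [one_div_pow, one_div_pow, ← pow_mul, ← pow_mul, mul_comm r 2]
    ring
  rw [hsplit]
  refine (abs_binExp_le hp hp1 hpt).trans ?_
  simp only [binExp_add, binExp_const_mul, M0]
  have hI2 : binExp n p (fun k => 1 / (a + (k : ℝ)) ^ (2 * r)) ≤ C / m ^ (2 * r) := by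
    rw [le_div_iff₀ (by positivity)]
    linarith
  calc _ ≤ K / m ^ 3 / P * (41 * m ^ 3) + (K / m ^ 3 * P * (C / m ^ (2 * r)) +
        K / m ^ 3 * P / m ^ (2 * r) * 1) := by gcongr
    _ = 41 * K / P + K * (C + 1) * (P ^ 2 / m ^ (2 * r + 3)) / P := by
      rw [pow_add]
      field_simp
    _ = K * (41 + C + 1) / P := by
      rw [hP2, div_self (by positivity)]
      ring
    _ ≤ (K * (41 + C + 1) + 1) / P := by
      gcongr
      linarith
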